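/- For every 3d partition λ and every integer k ≥ 0, the sum ∑_{■ ∈ Add(λ) ∪ Rem(λ)} Res_{z = x_■} ( z^k · H_λ(z) ) equals the coefficient of z^{−k−1} in the expansion of H_λ(z) as a formal Laurent series in z^{−1}, i.e. in the image of H_λ(z) under the canonical embedding K(z) ↪ K((z^{−1})). -/

import Mathlib

/-- A box in `ℕ³`. -/
abbrev Box3 : Type := ℕ × ℕ × ℕ

/-- A set of boxes is downward closed; a 3d partition is a finite downward closed
subset of `ℕ³`. -/
def IsDownwardClosed (S : Set Box3) : Prop :=
  ∀ b ∈ S, ∀ b' : Box3, b'.1 ≤ b.1 → b'.2.1 ≤ b.2.1 → b'.2.2 ≤ b.2.2 → b' ∈ S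

/-- The field `K = ℚ(ℏ₁, ℏ₂, χ)` of rational functions in three indeterminates. -/
abbrev KK : Type := FractionRing (MvPolynomial (Fin 3) ℚ)

/-- The equivariant parameter `ℏ₁`. -/
noncomputable def hb1 : KK := algebraMap (MvPolynomial (Fin 3) ℚ) KK (MvPolynomial.X 0)

/-- The equivariant parameter `ℏ₂`. -/
noncomputable def hb2 : KK := algebraMap (MvPolynomial (Fin 3) ℚ) KK (MvPolynomial.X 1)

/-- The equivariant parameter `ℏ₃ := −ℏ₁ − ℏ₂` (so `ℏ₁ + ℏ₂ + ℏ₃ = 0`). -/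
noncomputable def hb3 : KK := -hb1 - hb2

/-- The framing parameter `χ`. -/
noncomputable def chiK : KK := algebraMap (MvPolynomial (Fin 3) ℚ) KK (MvPolynomial.X 2)

/-- The three parameters `ℏ₁, ℏ₂, ℏ₃` as a function on `Fin 3`. -/
noncomputable def hbar : Fin 3 → KK := ![hb1, hb2, hb3]

/-- The weight `x_□ = χ + i·ℏ₁ + j·ℏ₂ + k·ℏ₃` of a box `□ = (i,j,k)`. -/
noncomputable def boxWeight (b : Box3) : KK :=
  chiK + (b.1 : KK) * hb1 + (b.2.1 : KK) * hb2 + (b.2.2 : KK) * hb3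

/-- The set of addible boxes of `λ`: boxes `■ ∉ λ` with `λ ∪ {■}` downward closed. -/
def AddBoxes (lam : Finset Box3) : Set Box3 :=
  { b | b ∉ lam ∧ IsDownwardClosed (↑(insert b lam) : Set Box3) }

/-- The set of removable boxes of `λ`: boxes `■ ∈ λ` with `λ \ {■}` downward closed. -/
def RemBoxes (lam : Finset Box3) : Set Box3 :=
  { b | b ∈ lam ∧ IsDownwardClosed (↑(lam.erase b) : Set Box3) }

/-- `H_λ(z) = (z−χ)⁻¹ · ∏_{□∈λ} ∏_{t=1,2,3} (z − x_□ + ℏ_t)/(z − x_□ − ℏ_t) ∈ K(z)`. -/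
noncomputable def Hfun (lam : Finset Box3) : RatFunc KK :=
  (RatFunc.X - RatFunc.C chiK)⁻¹ *
    ∏ b ∈ lam, ∏ t : Fin 3,
      (RatFunc.X - RatFunc.C (boxWeight b) + RatFunc.C (hbar t)) /
        (RatFunc.X - RatFunc.C (boxWeight b) - RatFunc.C (hbar t))

/-- The residue at `z = a` of a rational function `f ∈ K(z)`: the coefficient of
`(z−a)⁻¹` in the Laurent expansion of `f` at `z = a`. -/
noncomputable def resAt (a : KK) (f : RatFunc KK) : KK :=
  ((RatFunc.laurent a f : RatFunc KK) : LaurentSeries KK).coeff (-1)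

/-- The expansion of a rational function as a formal Laurent series in `z⁻¹`,
i.e. the canonical embedding `K(z) ↪ K((z⁻¹))`, realized inside `K((w))` by the
substitution `z = w⁻¹`; the coefficient of `z^{−m}` of `f` is `(expAtInf f).coeff m`. -/
noncomputable def expAtInf (f : RatFunc KK) : LaurentSeries KK :=
  RatFunc.eval (algebraMap KK (LaurentSeries KK))
    ((HahnSeries.single (1 : ℤ) (1 : KK))⁻¹) f

namespace RatFunc

section Residue

open Polynomial

variable {K : Type*} [Field K]

/-- The residue of a rational function at `a`. -/
noncomputable def residue (a : K) : RatFunc K →+ K where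
  toFun f := ((laurent a f : RatFunc K) : LaurentSeries K).coeff (-1)
  map_zero' := by simp
  map_add' f g := by simp

theorem algebraMap_laurentSeries_eq_coe_C (c : K) :
    algebraMap K (LaurentSeries K) c = ((C c : RatFunc K) : LaurentSeries K) := by
  rw [← algebraMap_C, ← coePolynomial_eq_algebraMap, ← coe_coe, HahnSeries.algebraMap_apply']
  simp

theorem transcendental_inv_single :
    Transcendental K ((HahnSeries.single (1 : ℤ) (1 : K))⁻¹ : LaurentSeries K) := by
  have := IsScalarTower.of_algebraMap_eq (algebraMap_laurentSeries_eq_coe_C (K := K))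
  have h : Transcendental K ((RatFunc.X : RatFunc K) : LaurentSeries K) :=
    (transcendental_algebraMap_iff (algebraMap (RatFunc K) (LaurentSeries K)).injective).2
      transcendental_X
  rw [coe_X] at h
  exact fun halg => h (IsAlgebraic.inv_iff.1 halg)

/-- The embedding `K(z) ↪ K((z⁻¹))`. -/
noncomputable def expansionAtInfty : RatFunc K →ₐ[K] LaurentSeries K :=
  (IntermediateField.val _).comp
    (algEquivOfTranscendental _ (transcendental_inv_single (K := K))).toAlgHom

theorem expansionAtInfty_apply (f : RatFunc K) :
    expansionAtInfty f = eval (algebraMap K (LaurentSeries K))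
      ((HahnSeries.single (1 : ℤ) (1 : K))⁻¹) f :=
  algEquivOfTranscendental_apply _ _ f

theorem expansionAtInfty_X :
    expansionAtInfty (X : RatFunc K) = HahnSeries.single (-1 : ℤ) (1 : K) := by
  simp [expansionAtInfty_apply, HahnSeries.inv_single]

theorem expansionAtInfty_C (c : K) :
    expansionAtInfty (C c) = HahnSeries.single (0 : ℤ) c := by
  simp [expansionAtInfty_apply, HahnSeries.algebraMap_apply', HahnSeries.C_apply]

theorem coeff_expansionAtInfty_X_pow_mul (k : ℕ) (f : RatFunc K) (n : ℤ) :
    (expansionAtInfty (X ^ k * f)).coeff n = (expansionAtInfty f).coeff (n + k) := by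
  have := HahnSeries.coeff_single_mul_add (r := (1 : K)) (x := expansionAtInfty f)
    (a := n + k) (b := -(k : ℤ))
  simpa [expansionAtInfty_X, HahnSeries.single_pow] using this

theorem coeff_expansionAtInfty_algebraMap (p : K[X]) :
    (expansionAtInfty (algebraMap K[X] (RatFunc K) p)).coeff 1 = 0 := by
  induction p using Polynomial.induction_on' with
  | add p q hp hq => simp [hp, hq]
  | monomial n c =>
    simp only [algebraMap_monomial, map_mul, map_pow, expansionAtInfty_X, expansionAtInfty_C]
    simp [HahnSeries.single_pow, HahnSeries.coeff_single_of_ne, show (1 : ℤ) ≠ -n by lia]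

theorem X_sub_C_ne_zero (a : K) : (X - C a : RatFunc K) ≠ 0 := by
  rw [← algebraMap_X, ← algebraMap_C, ← map_sub]
  exact algebraMap_ne_zero (Polynomial.X_sub_C_ne_zero a)

theorem expansionAtInfty_inv_X_sub_C (b : K) :
    expansionAtInfty ((X - C b)⁻¹ : RatFunc K) = HahnSeries.single (1 : ℤ) 1 *
      HahnSeries.ofPowerSeries ℤ K (PowerSeries.mk fun n => b ^ n) := by
  rw [map_inv₀]
  apply inv_eq_of_mul_eq_one_right
  have h : (1 - PowerSeries.C b * PowerSeries.X) * PowerSeries.mk (fun n => b ^ n) = 1 := by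
    ext n
    cases n <;> simp [sub_mul, mul_assoc, pow_succ', PowerSeries.coeff_one]
  have h' := congrArg (HahnSeries.ofPowerSeries ℤ K) h
  rw [map_mul, map_one] at h'
  rw [← h', map_sub, expansionAtInfty_X, expansionAtInfty_C, ← mul_assoc]
  simp [sub_mul]

theorem coeff_expansionAtInfty_inv_X_sub_C_pow (b c : K) (m : ℕ) :
    (expansionAtInfty (C c * ((X - C b)⁻¹ : RatFunc K) ^ (m + 1))).coeff 1 =
      if m = 0 then c else 0 := by
  rw [map_mul, map_pow, expansionAtInfty_inv_X_sub_C, expansionAtInfty_C, mul_pow,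
    HahnSeries.single_pow, one_pow, ← map_pow, ← mul_assoc, HahnSeries.single_mul_single]
  have := HahnSeries.coeff_single_mul_add (r := c * 1)
    (x := HahnSeries.ofPowerSeries ℤ K ((PowerSeries.mk fun n => b ^ n) ^ (m + 1)))
    (a := -(m : ℤ)) (b := 0 + (m + 1) • (1 : ℤ))
  rw [show -(m : ℤ) + (0 + (m + 1) • (1 : ℤ)) = 1 by simp] at this
  rw [this, PowerSeries.coeff_coe]
  split_ifs with h₁ h₂ h₂
  · lia
  · simp
  · subst h₂
    simp
  · lia

theorem residue_div_eq_zero {a : K} (p q : K[X]) (hq : q.eval a ≠ 0) :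
    residue a (algebraMap _ _ p / algebraMap _ _ q) = 0 := by
  have hq' : PowerSeries.constantCoeff (taylor a q : PowerSeries K) ≠ 0 := by
    simpa [taylor_coeff_zero] using hq
  have h : ((laurent a (algebraMap _ _ p / algebraMap _ _ q) : RatFunc K) : LaurentSeries K) =
      HahnSeries.ofPowerSeries ℤ K
        ((taylor a p : PowerSeries K) * (taylor a q : PowerSeries K)⁻¹) := by
    have h1 := congrArg (HahnSeries.ofPowerSeries ℤ K) (PowerSeries.mul_inv_cancel _ hq')
    rw [map_mul, map_one] at h1
    rw [laurent_div, map_div₀, map_mul, div_eq_mul_inv, ← coePolynomial_eq_algebraMap,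
      ← coePolynomial_eq_algebraMap, ← coe_coe, ← coe_coe, inv_eq_of_mul_eq_one_right h1]
  change HahnSeries.coeff (algebraMap (RatFunc K) (LaurentSeries K) _) _ = _
  rw [h, PowerSeries.coeff_coe]
  simp

theorem residue_algebraMap (a : K) (p : K[X]) :
    residue a (algebraMap _ _ p) = 0 := by
  simpa using residue_div_eq_zero (a := a) p 1 (by simp)

theorem residue_inv_X_sub_C_pow [DecidableEq K] (a b c : K) (m : ℕ) :
    residue a (C c * ((X - C b)⁻¹ : RatFunc K) ^ (m + 1)) =
      if a = b ∧ m = 0 then c else 0 := by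
  by_cases hab : a = b
  · subst hab
    change HahnSeries.coeff (algebraMap (RatFunc K) (LaurentSeries K) _) _ = _
    have h : ((laurent a (C c * (X - C a)⁻¹ ^ (m + 1)) : RatFunc K) : LaurentSeries K) =
        HahnSeries.single (-(m + 1 : ℤ)) c := by
      simp only [map_mul, map_pow, map_inv₀, map_sub, laurent_X, laurent_C,
        add_sub_cancel_right, coe_X, HahnSeries.inv_single]
      rw [← algebraMap_laurentSeries_eq_coe_C]
      simp [HahnSeries.single_pow, HahnSeries.algebraMap_apply', HahnSeries.C_apply,
        HahnSeries.single_mul_single]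
    rw [h, HahnSeries.coeff_single]
    grind
  · have := residue_div_eq_zero (a := a) (Polynomial.C c)
      ((Polynomial.X - Polynomial.C b) ^ (m + 1)) (by simp [sub_eq_zero, hab])
    simpa [algebraMap_C, hab, div_eq_mul_inv] using this

theorem sum_residue_eq_coeff_expansionAtInfty (p : K[X]) (T : Finset K) (n : K → ℕ) :
    ∑ a ∈ T, residue a (algebraMap _ _ p * ∏ b ∈ T, ((X - C b)⁻¹ : RatFunc K) ^ n b) =
      (expansionAtInfty (algebraMap _ _ p * ∏ b ∈ T, ((X - C b)⁻¹ : RatFunc K) ^ n b)).coeff 1 := by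
  classical
  obtain ⟨q, r, hr, h⟩ := mul_prod_pow_inverse_eq_quo_add_sum_rem_mul_pow_inverse (K := RatFunc K)
    (s := T) p (g := fun b => Polynomial.X - Polynomial.C b) (fun b _ => monic_X_sub_C b)
    (fun b _ c _ hbc => pairwise_coprime_X_sub_C Function.injective_id hbc) n
    (gi := fun b => (X - C b)⁻¹)
    (fun b _ => by simp [inv_mul_cancel₀ (X_sub_C_ne_zero b)])
  have hc : ∀ b ∈ T, ∀ j, algebraMap K[X] (RatFunc K) (r b j) = C ((r b j).coeff 0) := by
    intro b hb j
    have := hr b hb j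
    rw [degree_X_sub_C] at this
    rw [← algebraMap_C, ← eq_C_of_degree_le_zero (Nat.WithBot.lt_one_iff_le_zero.1 this)]
  have h' : ∑ b ∈ T, ∑ j, algebraMap K[X] (RatFunc K) (r b j) * ((X - C b)⁻¹) ^ (j.1 + 1) =
      ∑ b ∈ T, ∑ j, C ((r b j).coeff 0) * ((X - C b)⁻¹) ^ (j.1 + 1) :=
    Finset.sum_congr rfl fun b hb => Finset.sum_congr rfl fun j _ => by rw [hc b hb j]
  rw [h, h']
  simp only [map_add, map_sum, residue_algebraMap, residue_inv_X_sub_C_pow, zero_add,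
    HahnSeries.coeff_add, HahnSeries.coeff_sum, coeff_expansionAtInfty_algebraMap,
    coeff_expansionAtInfty_inv_X_sub_C_pow]
  rw [Finset.sum_comm]
  refine Finset.sum_congr rfl fun b hb => ?_
  rw [Finset.sum_comm]
  refine Finset.sum_congr rfl fun j _ => ?_
  simp [ite_and, hb]

theorem residue_eq_zero_of_count_le [DecidableEq K] {a : K} (p : K[X]) {s t : Multiset K}
    (h : s.count a ≤ t.count a) :
    residue a (algebraMap _ _ (p * (t.map fun b => Polynomial.X - Polynomial.C b).prod) /
      algebraMap _ _ (s.map fun b => Polynomial.X - Polynomial.C b).prod) = 0 := by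
  obtain ⟨u, hu, hs⟩ : ∃ u, a ∉ u ∧ s = Multiset.replicate (s.count a) a + u := by
    refine ⟨s.filter (· ≠ a), by simp, ?_⟩
    rw [← Multiset.filter_eq', add_comm]
    simpa using (Multiset.filter_add_not (· ≠ a) s).symm
  obtain ⟨v, hv⟩ := Multiset.le_iff_exists_add.1 (Multiset.le_count_iff_replicate_le.1 h)
  generalize s.count a = m at hs hv
  subst hs hv
  have hf :
      algebraMap K[X] (RatFunc K)
          (p * ((Multiset.replicate m a + v).map fun b => Polynomial.X - Polynomial.C b).prod) /
        algebraMap _ _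
          ((Multiset.replicate m a + u).map fun b => Polynomial.X - Polynomial.C b).prod =
      algebraMap _ _ (p * (v.map fun b => Polynomial.X - Polynomial.C b).prod) /
        algebraMap _ _ (u.map fun b => Polynomial.X - Polynomial.C b).prod := by
    have h0 : algebraMap K[X] (RatFunc K) ((Polynomial.X - Polynomial.C a) ^ m) ≠ 0 :=
      algebraMap_ne_zero (pow_ne_zero _ (Polynomial.X_sub_C_ne_zero a))
    rw [Multiset.map_add, Multiset.map_add, Multiset.prod_add, Multiset.prod_add,
      Multiset.map_replicate, Multiset.prod_replicate, mul_left_comm, map_mul,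
      map_mul (algebraMap K[X] (RatFunc K)) (_ ^ _), mul_div_mul_left _ _ h0]
  rw [hf]
  apply residue_div_eq_zero
  rw [eval_multiset_prod, Multiset.map_map]
  refine Multiset.prod_ne_zero fun h0 => ?_
  obtain ⟨b, hb, hba⟩ := Multiset.mem_map.1 h0
  simp only [Function.comp_apply, eval_sub, Polynomial.eval_X, Polynomial.eval_C,
    sub_eq_zero] at hba
  exact hu (hba ▸ hb)

/-- The residue theorem for a rational function given by its zeros and poles: it suffices to sum
over the points that are not cancelled. -/
theorem sum_residue_eq_coeff_of_count_le [DecidableEq K] (p : K[X]) (s t : Multiset K)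
    (S : Finset K) (h : ∀ a ∉ S, s.count a ≤ t.count a) (f : RatFunc K)
    (hf : f = algebraMap _ _ (p * (t.map fun b => Polynomial.X - Polynomial.C b).prod) /
      algebraMap _ _ (s.map fun b => Polynomial.X - Polynomial.C b).prod) :
    ∑ a ∈ S, residue a f = (expansionAtInfty f).coeff 1 := by
  have hT := sum_residue_eq_coeff_expansionAtInfty
    (p * (t.map fun b => Polynomial.X - Polynomial.C b).prod) (S ∪ s.toFinset) (s.count ·)
  have hfT : algebraMap _ _ (p * (t.map fun b => Polynomial.X - Polynomial.C b).prod) *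
      ∏ b ∈ S ∪ s.toFinset, ((X - C b)⁻¹ : RatFunc K) ^ s.count b = f := by
    rw [hf, div_eq_mul_inv, ← Finset.prod_subset Finset.subset_union_right, map_multiset_prod,
      Multiset.map_map, Finset.prod_multiset_map_count]
    · simp [Finset.prod_multiset_map_count s]
    · intro b _ hb
      rw [Multiset.mem_toFinset] at hb
      simp [Multiset.count_eq_zero_of_notMem hb]
  rw [hfT] at hT
  rw [← hT]
  refine Finset.sum_subset Finset.subset_union_left fun a _ ha => ?_
  rw [hf]
  exact residue_eq_zero_of_count_le p (h a ha)

end Residue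

end RatFunc

/-- Whether the lattice point `(i, j, k)` is a box of `lam`. -/
def HasBoxAt (lam : Finset Box3) (i j k : ℤ) : Prop :=
  ∃ b ∈ lam, (b.1 : ℤ) = i ∧ (b.2.1 : ℤ) = j ∧ (b.2.2 : ℤ) = k

theorem HasBoxAt.nonneg {lam : Finset Box3} {i j k : ℤ} (h : HasBoxAt lam i j k) :
    0 ≤ i ∧ 0 ≤ j ∧ 0 ≤ k := by
  obtain ⟨b, -, rfl, rfl, rfl⟩ := h
  simp

theorem hasBoxAt_natCast {lam : Finset Box3} {b : Box3} :
    HasBoxAt lam b.1 b.2.1 b.2.2 ↔ b ∈ lam := by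
  constructor
  · rintro ⟨c, hc, h1, h2, h3⟩
    have : c = b := by ext <;> lia
    exact this ▸ hc
  · exact fun h => ⟨b, h, rfl, rfl, rfl⟩

theorem HasBoxAt.mono {lam : Finset Box3} (hlam : IsDownwardClosed (↑lam : Set Box3))
    {i j k i' j' k' : ℤ} (h : HasBoxAt lam i' j' k') (hi : 0 ≤ i) (hj : 0 ≤ j) (hk : 0 ≤ k)
    (hi' : i ≤ i') (hj' : j ≤ j') (hk' : k ≤ k') : HasBoxAt lam i j k := by
  obtain ⟨b, hb, rfl, rfl, rfl⟩ := h
  lift i to ℕ using hi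
  lift j to ℕ using hj
  lift k to ℕ using hk
  exact hasBoxAt_natCast (b := (i, j, k)).2
    (hlam b hb (i, j, k) (by simpa using hi') (by simpa using hj') (by simpa using hk'))

theorem mem_remBoxes {lam : Finset Box3} (hlam : IsDownwardClosed (↑lam : Set Box3)) {b : Box3}
    (hb : b ∈ lam) (h1 : ¬ HasBoxAt lam (b.1 + 1) b.2.1 b.2.2)
    (h2 : ¬ HasBoxAt lam b.1 (b.2.1 + 1) b.2.2) (h3 : ¬ HasBoxAt lam b.1 b.2.1 (b.2.2 + 1)) :
    b ∈ RemBoxes lam := by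
  refine ⟨hb, fun c hc d h1' h2' h3' => ?_⟩
  simp only [Finset.coe_erase, Set.mem_sdiff, Finset.mem_coe, Set.mem_singleton_iff] at hc ⊢
  refine ⟨hlam c hc.1 d h1' h2' h3', ?_⟩
  rintro rfl
  have hc' := hasBoxAt_natCast.2 hc.1
  have : d.1 < c.1 ∨ d.2.1 < c.2.1 ∨ d.2.2 < c.2.2 := by
    by_contra! h
    exact hc.2 (by ext <;> lia)
  rcases this with h | h | h
  · exact h1 (hc'.mono hlam (by lia) (by lia) (by lia) (by lia) (by lia) (by lia))
  · exact h2 (hc'.mono hlam (by lia) (by lia) (by lia) (by lia) (by lia) (by lia))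
  · exact h3 (hc'.mono hlam (by lia) (by lia) (by lia) (by lia) (by lia) (by lia))

theorem mem_addBoxes {lam : Finset Box3} (hlam : IsDownwardClosed (↑lam : Set Box3)) {b : Box3}
    (hb : b ∉ lam) (h1 : 0 < b.1 → HasBoxAt lam (b.1 - 1) b.2.1 b.2.2)
    (h2 : 0 < b.2.1 → HasBoxAt lam b.1 (b.2.1 - 1) b.2.2)
    (h3 : 0 < b.2.2 → HasBoxAt lam b.1 b.2.1 (b.2.2 - 1)) :
    b ∈ AddBoxes lam := by
  refine ⟨hb, fun c hc d h1' h2' h3' => ?_⟩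
  simp only [Finset.coe_insert, Set.mem_insert_iff, Finset.mem_coe] at hc ⊢
  rcases hc with rfl | hc
  · by_contra! hd
    have : d.1 < c.1 ∨ d.2.1 < c.2.1 ∨ d.2.2 < c.2.2 := by
      by_contra! h
      exact hd.1 (by ext <;> lia)
    refine hd.2 (hasBoxAt_natCast.1 ?_)
    rcases this with h | h | h
    · exact (h1 (by lia)).mono hlam (by lia) (by lia) (by lia) (by lia) (by lia) (by lia)
    · exact (h2 (by lia)).mono hlam (by lia) (by lia) (by lia) (by lia) (by lia) (by lia)
    · exact (h3 (by lia)).mono hlam (by lia) (by lia) (by lia) (by lia) (by lia) (by lia)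
  · exact .inr (hlam c hc d h1' h2' h3')

open scoped Classical in
/-- The local form of the pole bound, at the unit cube with lowest vertex `(i, j, k)`. -/
theorem cube_vertices_le {lam : Finset Box3} (hlam : IsDownwardClosed (↑lam : Set Box3))
    (i j k : ℤ)
    (hrem : HasBoxAt lam i j k → HasBoxAt lam (i + 1) j k ∨ HasBoxAt lam i (j + 1) k ∨
      HasBoxAt lam i j (k + 1))
    (hadd : -1 ≤ i → -1 ≤ j → -1 ≤ k → ¬ HasBoxAt lam (i + 1) (j + 1) (k + 1) →
      (0 ≤ i ∧ ¬ HasBoxAt lam i (j + 1) (k + 1)) ∨ (0 ≤ j ∧ ¬ HasBoxAt lam (i + 1) j (k + 1)) ∨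
      (0 ≤ k ∧ ¬ HasBoxAt lam (i + 1) (j + 1) k)) :
    (if HasBoxAt lam i (j + 1) (k + 1) then 1 else 0) +
      (if HasBoxAt lam (i + 1) j (k + 1) then 1 else 0) +
      (if HasBoxAt lam (i + 1) (j + 1) k then 1 else 0) +
      (if HasBoxAt lam i j k then 1 else 0) +
      (if i = -1 ∧ j = -1 ∧ k = -1 then 1 else 0) ≤
    (if HasBoxAt lam (i + 1) j k then 1 else 0) + (if HasBoxAt lam i (j + 1) k then 1 else 0) +
      (if HasBoxAt lam i j (k + 1) then 1 else 0) +
      (if HasBoxAt lam (i + 1) (j + 1) (k + 1) then 1 else 0) := by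
  have hpos := @HasBoxAt.nonneg lam
  have hmono := fun i j k i' j' k' => @HasBoxAt.mono lam hlam i j k i' j' k'
  generalize HasBoxAt lam = P at *
  have a000 := @hpos i j k
  have a100 := @hpos (i+1) j k
  have a010 := @hpos i (j+1) k
  have a001 := @hpos i j (k+1)
  have a011 := @hpos i (j+1) (k+1)
  have a101 := @hpos (i+1) j (k+1)
  have a110 := @hpos (i+1) (j+1) k
  have a111 := @hpos (i+1) (j+1) (k+1)
  have b1 := hmono i (j+1) (k+1) (i+1) (j+1) (k+1)
  have b2 := hmono (i+1) j (k+1) (i+1) (j+1) (k+1)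
  have b3 := hmono (i+1) (j+1) k (i+1) (j+1) (k+1)
  have c1 := hmono (i+1) j k (i+1) (j+1) k
  have c2 := hmono (i+1) j k (i+1) j (k+1)
  have c3 := hmono i (j+1) k (i+1) (j+1) k
  have c4 := hmono i (j+1) k i (j+1) (k+1)
  have c5 := hmono i j (k+1) i (j+1) (k+1)
  have c6 := hmono i j (k+1) (i+1) j (k+1)
  have d1 := hmono i j k (i+1) j k
  have d2 := hmono i j k i (j+1) k
  have d3 := hmono i j k i j (k+1)
  clear hpos hmono
  grind (splits := 30)

/-- The weight of a lattice point. -/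
noncomputable def pointWeight (p : ℤ × ℤ × ℤ) : KK :=
  chiK + (p.1 : KK) * hb1 + (p.2.1 : KK) * hb2 + (p.2.2 : KK) * hb3

open scoped Classical in
theorem card_filter_hasBoxAt (lam : Finset Box3) (B : Finset (ℤ × ℤ × ℤ)) (a c : KK) (x y z : ℤ)
    (hB : ∀ b ∈ lam, ((b.1 : ℤ) - x, (b.2.1 : ℤ) - y, (b.2.2 : ℤ) - z) ∈ B)
    (hc : c = x * hb1 + y * hb2 + z * hb3) :
    ∑ p ∈ B with pointWeight p = a,
        (if HasBoxAt lam (p.1 + x) (p.2.1 + y) (p.2.2 + z) then 1 else 0) =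
      (lam.filter fun b => a = boxWeight b - c).card := by
  have hw (b : Box3) : pointWeight ((b.1 : ℤ) - x, (b.2.1 : ℤ) - y, (b.2.2 : ℤ) - z) =
      boxWeight b - c := by
    simp only [pointWeight, boxWeight, hc]
    push_cast
    ring
  rw [← Finset.sum_filter, ← Finset.card_eq_sum_ones]
  symm
  refine Finset.card_nbij (fun b => ((b.1 : ℤ) - x, (b.2.1 : ℤ) - y, (b.2.2 : ℤ) - z)) ?_ ?_ ?_
  · intro b hb
    rw [Finset.mem_coe, Finset.mem_filter] at hb
    exact Finset.mem_coe.2 (Finset.mem_filter.2 ⟨Finset.mem_filter.2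
      ⟨hB b hb.1, by rw [hw, hb.2]⟩, b, hb.1, by simp, by simp, by simp⟩)
  · intro b _ c _ h
    simp only [Prod.mk.injEq] at h
    ext <;> lia
  · rintro ⟨p, q, r⟩ hp
    simp only [Finset.coe_filter, Finset.mem_filter, Set.mem_ofPred_eq] at hp
    obtain ⟨⟨-, hpa⟩, b, hb, h1, h2, h3⟩ := hp
    have he : ((b.1 : ℤ) - x, (b.2.1 : ℤ) - y, (b.2.2 : ℤ) - z) = (p, q, r) := by
      ext <;> simp <;> lia
    refine ⟨b, ?_, he⟩
    simp only [Finset.coe_filter, Set.mem_ofPred_eq]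
    exact ⟨hb, by rw [← hw, he, hpa]⟩

open scoped Classical in
/-- Away from the weights of the addible and removable boxes, the zeros of `Hfun lam` cancel its
poles. -/
theorem card_poles_le_card_zeros {lam : Finset Box3}
    (hlam : IsDownwardClosed (↑lam : Set Box3)) {a : KK}
    (ha : ∀ b ∈ AddBoxes lam ∪ RemBoxes lam, boxWeight b ≠ a) :
    (lam.filter fun b => a = boxWeight b + hb1).card +
      (lam.filter fun b => a = boxWeight b + hb2).card +
      (lam.filter fun b => a = boxWeight b + hb3).card + (if a = chiK then 1 else 0) ≤
    (lam.filter fun b => a = boxWeight b - hb1).card +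
      (lam.filter fun b => a = boxWeight b - hb2).card +
      (lam.filter fun b => a = boxWeight b - hb3).card := by
  let V : Finset (ℤ × ℤ × ℤ) := {0, 1} ×ˢ {0, 1} ×ˢ {0, 1}
  let B : Finset (ℤ × ℤ × ℤ) := insert (-1, -1, -1)
    ((lam ×ˢ V).image fun q => ((q.1.1 : ℤ) - q.2.1, (q.1.2.1 : ℤ) - q.2.2.1,
      (q.1.2.2 : ℤ) - q.2.2.2))
  have hB (x y z : ℤ) (hx : x = 0 ∨ x = 1) (hy : y = 0 ∨ y = 1) (hz : z = 0 ∨ z = 1) :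
      ∀ b ∈ lam, ((b.1 : ℤ) - x, (b.2.1 : ℤ) - y, (b.2.2 : ℤ) - z) ∈ B := by
    intro b hb
    refine Finset.mem_insert_of_mem (Finset.mem_image.2 ⟨(b, x, y, z), ?_, rfl⟩)
    simp [V, hb, hx, hy, hz]
  have hcube : ∀ p ∈ B.filter (pointWeight · = a), _ ≤ _ := fun p hp =>
    cube_vertices_le hlam p.1 p.2.1 p.2.2
      (fun h => by
        by_contra! h'
        obtain ⟨b, hb, h1, h2, h3⟩ := h
        rw [← h1, ← h2, ← h3] at h'
        refine ha b (.inr (mem_remBoxes hlam hb h'.1 h'.2.1 h'.2.2)) ?_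
        rw [← (Finset.mem_filter.1 hp).2]
        simp [boxWeight, pointWeight, ← h1, ← h2, ← h3])
      (fun hi hj hk h => by
        by_contra! h'
        obtain ⟨p1, p2, p3⟩ := p
        obtain ⟨i, rfl⟩ : ∃ i : ℕ, p1 = i - 1 := ⟨(p1 + 1).toNat, by grind⟩
        obtain ⟨j, rfl⟩ : ∃ i : ℕ, p2 = i - 1 := ⟨(p2 + 1).toNat, by grind⟩
        obtain ⟨k, rfl⟩ : ∃ i : ℕ, p3 = i - 1 := ⟨(p3 + 1).toNat, by grind⟩
        simp only [sub_add_cancel] at h h'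
        refine ha (i, j, k) (.inl (mem_addBoxes hlam (mt hasBoxAt_natCast.2 h)
          (fun h0 => h'.1 (by grind)) (fun h0 => h'.2.1 (by grind))
          (fun h0 => h'.2.2 (by grind)))) ?_
        rw [← (Finset.mem_filter.1 hp).2]
        simp [boxWeight, pointWeight, hb3]
        ring)
  have hsum := Finset.sum_le_sum hcube
  have hcorner : ∑ p ∈ B with pointWeight p = a,
      (if p.1 = -1 ∧ p.2.1 = -1 ∧ p.2.2 = -1 then 1 else 0) = if a = chiK then 1 else 0 := by
    have hw : pointWeight (-1, -1, -1) = chiK := by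
      simp only [pointWeight, hb3]
      push_cast
      ring
    have he (p : ℤ × ℤ × ℤ) : (p.1 = -1 ∧ p.2.1 = -1 ∧ p.2.2 = -1) ↔ p = (-1, -1, -1) := by
      simp [Prod.ext_iff]
    simp only [he, Finset.sum_ite_eq', Finset.mem_filter, hw]
    simp [B, eq_comm]
  have key := card_filter_hasBoxAt lam B a
  have k011 := key (-hb1) 0 1 1 (hB _ _ _ (by simp) (by simp) (by simp)) (by simp [hb3])
  have k101 := key (-hb2) 1 0 1 (hB _ _ _ (by simp) (by simp) (by simp)) (by simp [hb3]; ring)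
  have k110 := key (-hb3) 1 1 0 (hB _ _ _ (by simp) (by simp) (by simp)) (by simp [hb3]; ring)
  have k000 := key 0 0 0 0 (hB _ _ _ (by simp) (by simp) (by simp)) (by simp)
  have k100 := key hb1 1 0 0 (hB _ _ _ (by simp) (by simp) (by simp)) (by simp)
  have k010 := key hb2 0 1 0 (hB _ _ _ (by simp) (by simp) (by simp)) (by simp)
  have k001 := key hb3 0 0 1 (hB _ _ _ (by simp) (by simp) (by simp)) (by simp)
  have k111 := key 0 1 1 1 (hB _ _ _ (by simp) (by simp) (by simp)) (by simp [hb3])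
  simp only [add_zero, sub_neg_eq_add] at k011 k101 k110 k000 k100 k010 k001 k111
  simp only [Finset.sum_add_distrib, k011, k101, k110, k000, k100, k010, k001, k111,
    hcorner] at hsum
  lia

theorem int_mul_hb1_add_int_mul_hb2_eq_zero {m n : ℤ} (h : (m : KK) * hb1 + (n : KK) * hb2 = 0) :
    m = 0 ∧ n = 0 := by
  have h' : (MvPolynomial.C (m : ℚ) * MvPolynomial.X 0 + MvPolynomial.C (n : ℚ) * MvPolynomial.X 1 :
      MvPolynomial (Fin 3) ℚ) = 0 := by
    apply IsFractionRing.injective (MvPolynomial (Fin 3) ℚ) KK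
    simpa [hb1, hb2] using h
  have h0 := congrArg (MvPolynomial.eval ![1, 0, 0]) h'
  have h1 := congrArg (MvPolynomial.eval ![0, 1, 0]) h'
  simp only [map_add, map_mul, MvPolynomial.eval_C, MvPolynomial.eval_X, map_zero] at h0 h1
  exact ⟨by simpa using h0, by simpa using h1⟩

/-- Distinct addible or removable boxes have distinct weights. -/
theorem boxWeight_injOn {lam : Finset Box3} (hlam : IsDownwardClosed (↑lam : Set Box3)) :
    Set.InjOn boxWeight (AddBoxes lam ∪ RemBoxes lam) := by
  have hdiag {b c : Box3} (h : boxWeight b = boxWeight c) :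
      (b.1 : ℤ) - c.1 = b.2.2 - c.2.2 ∧ (b.2.1 : ℤ) - c.2.1 = b.2.2 - c.2.2 := by
    have := int_mul_hb1_add_int_mul_hb2_eq_zero (m := (b.1 - c.1) - (b.2.2 - c.2.2))
      (n := (b.2.1 - c.2.1) - (b.2.2 - c.2.2)) (by
        simp only [boxWeight, hb3] at h
        push_cast
        linear_combination h)
    lia
  have hlt {b c : Box3} (hb : b ∈ AddBoxes lam ∪ RemBoxes lam)
      (hc : c ∈ AddBoxes lam ∪ RemBoxes lam) (h1 : b.1 < c.1) (h2 : b.2.1 < c.2.1)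
      (h3 : b.2.2 < c.2.2) : False := by
    have hmem : ((b.1 + 1, b.2.1, b.2.2) : Box3) ∈ lam := by
      rcases hc with hc | hc
      · have := hc.2 c (by simp) (b.1 + 1, b.2.1, b.2.2) h1 h2.le h3.le
        simp only [Finset.coe_insert, Set.mem_insert_iff, Finset.mem_coe] at this
        exact this.resolve_left fun h => by grind
      · exact hlam c hc.1 _ h1 h2.le h3.le
    rcases hb with hb | hb
    · exact hb.1 (hlam _ hmem b (by simp) le_rfl le_rfl)
    · have := hb.2 (b.1 + 1, b.2.1, b.2.2) (by simp [hmem, Prod.ext_iff]) b (by simp) le_rfl le_rfl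
      simp at this
  intro b hb c hc h
  have hd := hdiag h
  rcases lt_trichotomy b.1 c.1 with h1 | h1 | h1
  · exact (hlt hb hc h1 (by lia) (by lia)).elim
  · ext <;> lia
  · exact (hlt hc hb h1 (by lia) (by lia)).elim

/-- **Residue identity for the `[e,f] = h` relation of the `(−1)`-shifted affine
Yangian acting on the cohomology of the Hilbert schemes of points on `ℂ³`**:
for every 3d partition `λ` and every `k ≥ 0`, the sum over the addible and
removable boxes of `λ` of the residues of `z^k·H_λ(z)` at the corresponding
weights equals the coefficient of `z^{−k−1}` in the expansion of `H_λ(z)` as a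
formal Laurent series in `z⁻¹`. -/
theorem sum_residues_eq_coeff_atInf
    (lam : Finset Box3) (hlam : IsDownwardClosed (↑lam : Set Box3)) (k : ℕ)
    (S : Finset Box3) (hS : (↑S : Set Box3) = AddBoxes lam ∪ RemBoxes lam) :
    ∑ b ∈ S, resAt (boxWeight b) (RatFunc.X ^ k * Hfun lam)
      = (expAtInf (Hfun lam)).coeff ((k : ℤ) + 1) := by
  classical
  have hinj : Set.InjOn boxWeight S := hS ▸ boxWeight_injOn hlam
  let t : Multiset KK := lam.val.map (boxWeight · - hb1) + lam.val.map (boxWeight · - hb2) +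
    lam.val.map (boxWeight · - hb3)
  let s : Multiset KK := lam.val.map (boxWeight · + hb1) + lam.val.map (boxWeight · + hb2) +
    lam.val.map (boxWeight · + hb3) + {chiK}
  have hcount : ∀ a ∉ S.image boxWeight, s.count a ≤ t.count a := by
    intro a ha
    have := card_poles_le_card_zeros hlam (a := a) fun b hb hba =>
      ha (Finset.mem_image.2 ⟨b, by rwa [← Finset.mem_coe, hS], hba⟩)
    simpa [s, t, Multiset.count_map, Multiset.count_singleton, Finset.card_def] using this
  have hf : RatFunc.X ^ k * Hfun lam =
      algebraMap _ _ (Polynomial.X ^ k * (t.map fun b => Polynomial.X - Polynomial.C b).prod) /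
        algebraMap _ _ (s.map fun b => Polynomial.X - Polynomial.C b).prod := by
    simp only [Hfun, Fin.prod_univ_three, hbar, Matrix.cons_val,
      Finset.prod_mul_distrib, Finset.prod_div_distrib, sub_add, sub_sub]
    simp only [s, t, Multiset.map_add, Multiset.map_map, Multiset.prod_add, Function.comp_def,
      Multiset.map_singleton, Multiset.prod_singleton, Finset.prod_map_val, map_mul, map_pow,
      map_prod, map_sub, map_add, RatFunc.algebraMap_X, RatFunc.algebraMap_C,
      div_eq_mul_inv, mul_inv]
    ring
  have h := RatFunc.sum_residue_eq_coeff_of_count_le (Polynomial.X ^ k) s t (S.image boxWeight)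
    hcount _ hf
  rw [Finset.sum_image hinj, RatFunc.coeff_expansionAtInfty_X_pow_mul,
    RatFunc.expansionAtInfty_apply, add_comm] at h
  exact h
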